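/- Let k > 3 be an integer and let G = K_{k-1} □ C_4 be the Cartesian product of the complete graph on k-1 vertices with the 4-cycle (so G is k-regular), with the four induced copies of K_{k-1} labelled G_1, G_2, G_3, G_4 so that vertices of G_i are adjacent to those of G_{i+1 (mod 4)}. Let C_0 be the configuration in which every vertex of G_1 is a collaborator and every other vertex is a defector. Then for every win condition w with 1/2 ≤ w < (k-1)/(k+1), the w-power index process satisfies C_2 = C_0 and C_1 ≠ C_0; in particular the process is periodic with period 2. -/

import Mathlib

open scoped Classical

/-- A strategy of a voter: collaborator (`C`) or defector (`D`). -/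
inductive Strategy : Type
  | C : Strategy
  | D : Strategy
deriving DecidableEq

noncomputable section

variable {V : Type*}

/-- The closed neighbourhood `N[v]` of a vertex, as a finset. -/
def closedNbhd (G : SimpleGraph V) [Fintype V] (v : V) : Finset V :=
  Finset.univ.filter fun u => u = v ∨ G.Adj u v

/-- The (Shapley–Shubik style) power of a vertex `v` in configuration `c`
with win condition `w`. -/
def power (G : SimpleGraph V) [Fintype V] (w : ℝ) (c : V → Strategy) (v : V) : ℝ :=
  let N := closedNbhd G v
  let nC := (N.filter fun u => c u = Strategy.C).card
  let nD := (N.filter fun u => c u = Strategy.D).card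
  match c v with
  | Strategy.C => if w < (nC : ℝ) / (N.card : ℝ) then 1 / (nC : ℝ) else 0
  | Strategy.D => if (nC : ℝ) / (N.card : ℝ) ≤ w then 1 / (nD : ℝ) else 0

/-- One step of the `w`-power index process: every vertex adopts the strategy of a
vertex of maximum power in its closed neighbourhood, retaining its own strategy if
vertices of maximum power have differing strategies. -/
def step (G : SimpleGraph V) [Fintype V] (w : ℝ) (c : V → Strategy) (v : V) : Strategy :=
  let N := closedNbhd G v
  let M := N.filter fun u => ∀ x ∈ N, power G w c x ≤ power G w c u
  if ∀ u ∈ M, c u = Strategy.C then Strategy.C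
  else if ∀ u ∈ M, c u = Strategy.D then Strategy.D
  else c v

/-- `configSeq G w c0 i` is the configuration `C_i` of the `w`-power index process. -/
def configSeq (G : SimpleGraph V) [Fintype V] (w : ℝ) (c0 : V → Strategy) : ℕ → V → Strategy
  | 0 => c0
  | k + 1 => step G w (configSeq G w c0 k)

/-- The process is eventually stable. -/
def EventuallyStable (G : SimpleGraph V) [Fintype V] (w : ℝ) (c0 : V → Strategy) : Prop :=
  ∃ i, configSeq G w c0 (i + 1) = configSeq G w c0 i

/-- The process reaches a stable all-collaborator configuration. -/
def CollaboratorDominant (G : SimpleGraph V) [Fintype V] (w : ℝ) (c0 : V → Strategy) : Prop :=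
  ∃ i, configSeq G w c0 (i + 1) = configSeq G w c0 i ∧
    ∀ v, configSeq G w c0 i v = Strategy.C

/-- The process reaches a stable all-defector configuration. -/
def DefectorDominant (G : SimpleGraph V) [Fintype V] (w : ℝ) (c0 : V → Strategy) : Prop :=
  ∃ i, configSeq G w c0 (i + 1) = configSeq G w c0 i ∧
    ∀ v, configSeq G w c0 i v = Strategy.D

/-- The process is eventually periodic with period `ℓ`: `ℓ > 1` is the least integer
such that `C_i = C_{i+ℓ}` for some `i ≥ 0`. -/
def EventuallyPeriodicWithPeriod (G : SimpleGraph V) [Fintype V] (w : ℝ)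
    (c0 : V → Strategy) (ℓ : ℕ) : Prop :=
  IsLeast {m : ℕ | 1 < m ∧ ∃ i, configSeq G w c0 (i + m) = configSeq G w c0 i} ℓ

end

theorem mem_cn (k : ℕ) (u v : Fin (k - 1) × Fin 4) :
    u ∈ closedNbhd ((⊤ : SimpleGraph (Fin (k - 1))).boxProd (SimpleGraph.cycleGraph 4)) v ↔
      u.2 = v.2 ∨ (u.1 = v.1 ∧ (u.2 = v.2 + 1 ∨ u.2 = v.2 + 3)) := by
  obtain ⟨a, i⟩ := u
  obtain ⟨b, j⟩ := v
  have h : (SimpleGraph.cycleGraph 4).Adj i j ↔ (i = j + 1 ∨ i = j + 3) := by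
    rw [SimpleGraph.cycleGraph_adj]
    revert i j
    decide
  simp only [closedNbhd, Finset.mem_filter, Finset.mem_univ, true_and,
    SimpleGraph.boxProd_adj, SimpleGraph.top_adj, h, Prod.mk.injEq]
  tauto

theorem card_cn (k : ℕ) (v : Fin (k - 1) × Fin 4) (S : Fin 4 → Prop) :
    ((closedNbhd ((⊤ : SimpleGraph (Fin (k - 1))).boxProd (SimpleGraph.cycleGraph 4)) v).filter
      fun u => S u.2).card =
      (if S v.2 then k - 1 else 0) + (if S (v.2 + 1) then 1 else 0)
        + (if S (v.2 + 3) then 1 else 0) := by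
  have h1 : ((closedNbhd ((⊤ : SimpleGraph (Fin (k - 1))).boxProd
      (SimpleGraph.cycleGraph 4)) v).filter fun u => S u.2) =
      ((Finset.univ : Finset (Fin (k - 1))) ×ˢ (({v.2} : Finset (Fin 4)).filter S)) ∪
      ((({v.1} : Finset (Fin (k - 1))) ×ˢ (({v.2 + 1} : Finset (Fin 4)).filter S)) ∪
       (({v.1} : Finset (Fin (k - 1))) ×ˢ (({v.2 + 3} : Finset (Fin 4)).filter S))) := by
    ext u
    simp only [Finset.mem_filter, mem_cn, Finset.mem_union, Finset.mem_product, Finset.mem_univ,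
      Finset.mem_singleton, true_and]
    tauto
  have d1 : ∀ j : Fin 4, j ≠ j + 1 := by decide
  have d2 : ∀ j : Fin 4, j ≠ j + 3 := by decide
  have d3 : ∀ j : Fin 4, j + 1 ≠ j + 3 := by decide
  rw [h1, Finset.card_union_of_disjoint, Finset.card_union_of_disjoint]
  · simp only [Finset.card_product, Finset.filter_singleton, Finset.card_univ, Fintype.card_fin,
      Finset.card_singleton, one_mul]
    split_ifs <;> simp
  · rw [Finset.disjoint_left]
    intro u hu hu'
    simp only [Finset.mem_product, Finset.mem_filter, Finset.mem_singleton] at hu hu'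
    exact d3 _ (hu.2.1.symm.trans hu'.2.1)
  · rw [Finset.disjoint_left]
    intro u hu hu'
    simp only [Finset.mem_union, Finset.mem_product, Finset.mem_filter,
      Finset.mem_singleton] at hu hu'
    rcases hu' with h | h
    · exact d1 _ (hu.2.1.symm.trans h.2.1)
    · exact d2 _ (hu.2.1.symm.trans h.2.1)

theorem card_cn_all (k : ℕ) (hk : 3 < k) (v : Fin (k - 1) × Fin 4) :
    (closedNbhd ((⊤ : SimpleGraph (Fin (k - 1))).boxProd (SimpleGraph.cycleGraph 4)) v).card
      = k + 1 := by
  have h := card_cn k v (fun _ => True)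
  simp only [Finset.filter_true, if_true] at h
  rw [h]
  omega

theorem step_of_max {V : Type*} [Fintype V] (G : SimpleGraph V) (w : ℝ) (c : V → Strategy)
    (v u : V) (hu : u ∈ closedNbhd G v)
    (h : ∀ x ∈ closedNbhd G v, power G w c x ≤ power G w c u)
    (h' : ∀ x ∈ closedNbhd G v, power G w c u ≤ power G w c x → c x = c u) :
    step G w c v = c u := by
  have hM : ∀ x ∈ (closedNbhd G v).filter
      (fun u => ∀ x ∈ closedNbhd G v, power G w c x ≤ power G w c u), c x = c u := by
    intro x hx
    rw [Finset.mem_filter] at hx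
    exact h' x hx.1 (hx.2 u hu)
  have hum : u ∈ (closedNbhd G v).filter
      (fun u => ∀ x ∈ closedNbhd G v, power G w c x ≤ power G w c u) :=
    Finset.mem_filter.2 ⟨hu, h⟩
  unfold step
  simp only
  cases hc : c u with
  | C =>
    rw [if_pos]
    intro x hx
    rw [hM x hx, hc]
  | D =>
    rw [if_neg, if_pos]
    · intro x hx
      rw [hM x hx, hc]
    · intro hh
      have := hh u hum
      rw [hc] at this
      cases this

/-- The general step for configurations depending only on the copy. -/
theorem step_layer (k : ℕ) (w : ℝ) (f g : Fin 4 → Strategy) (P : Fin 4 → ℝ)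
    (hP : ∀ v, power ((⊤ : SimpleGraph (Fin (k - 1))).boxProd (SimpleGraph.cycleGraph 4)) w
      (fun p => f p.2) v = P v.2)
    (hg : ∀ i, ∃ j, (j = i ∨ j = i + 1 ∨ j = i + 3) ∧ f j = g i ∧
      ∀ l, (l = i ∨ l = i + 1 ∨ l = i + 3) → P l ≤ P j ∧ (P j ≤ P l → f l = f j)) :
    step ((⊤ : SimpleGraph (Fin (k - 1))).boxProd (SimpleGraph.cycleGraph 4)) w
      (fun p => f p.2) = fun p => g p.2 := by
  funext v
  obtain ⟨j, hj, hfg, hl⟩ := hg v.2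
  rw [← hfg]
  have hmain := step_of_max ((⊤ : SimpleGraph (Fin (k - 1))).boxProd (SimpleGraph.cycleGraph 4))
    w (fun p => f p.2) v (v.1, j)
  refine hmain ?_ ?_ ?_
  · rw [mem_cn]
    simpa using hj
  · intro x hx
    rw [mem_cn] at hx
    rw [hP, hP]
    exact (hl x.2 (by tauto)).1
  · intro x hx
    rw [mem_cn] at hx
    rw [hP, hP]
    exact (hl x.2 (by tauto)).2

theorem power_C (k : ℕ) (hk : 3 < k) (w : ℝ) (f : Fin 4 → Strategy) (v : Fin (k - 1) × Fin 4)
    (n : ℕ) (hf : f v.2 = Strategy.C)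
    (hn : (if f v.2 = Strategy.C then k - 1 else 0) + (if f (v.2 + 1) = Strategy.C then 1 else 0)
        + (if f (v.2 + 3) = Strategy.C then 1 else 0) = n)
    (hw : w < (n : ℝ) / ((k : ℝ) + 1)) :
    power ((⊤ : SimpleGraph (Fin (k - 1))).boxProd (SimpleGraph.cycleGraph 4)) w
      (fun p => f p.2) v = 1 / (n : ℝ) := by
  have hC := card_cn k v (fun i => f i = Strategy.C)
  have hn' : _ = n := hC.trans (by convert hn)
  unfold power
  simp only [hf, card_cn_all k hk]
  have hn2 : ((closedNbhd ((⊤ : SimpleGraph (Fin (k - 1))).boxProd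
      (SimpleGraph.cycleGraph 4)) v).filter fun u => f u.2 = Strategy.C).card = n := by
    convert hn'
  rw [hn2, if_pos]
  push_cast
  exact hw

theorem power_D (k : ℕ) (hk : 3 < k) (w : ℝ) (f : Fin 4 → Strategy) (v : Fin (k - 1) × Fin 4)
    (n m : ℕ) (hf : f v.2 = Strategy.D)
    (hn : (if f v.2 = Strategy.C then k - 1 else 0) + (if f (v.2 + 1) = Strategy.C then 1 else 0)
        + (if f (v.2 + 3) = Strategy.C then 1 else 0) = n)
    (hm : (if f v.2 = Strategy.D then k - 1 else 0) + (if f (v.2 + 1) = Strategy.D then 1 else 0)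
        + (if f (v.2 + 3) = Strategy.D then 1 else 0) = m)
    (hw : (n : ℝ) / ((k : ℝ) + 1) ≤ w) :
    power ((⊤ : SimpleGraph (Fin (k - 1))).boxProd (SimpleGraph.cycleGraph 4)) w
      (fun p => f p.2) v = 1 / (m : ℝ) := by
  have hC := card_cn k v (fun i => f i = Strategy.C)
  have hD := card_cn k v (fun i => f i = Strategy.D)
  have hn' : _ = n := hC.trans (by convert hn)
  have hm' : _ = m := hD.trans (by convert hm)
  unfold power
  simp only [hf, card_cn_all k hk]
  have hn2 : ((closedNbhd ((⊤ : SimpleGraph (Fin (k - 1))).boxProd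
      (SimpleGraph.cycleGraph 4)) v).filter fun u => f u.2 = Strategy.C).card = n := by
    convert hn'
  have hm2 : ((closedNbhd ((⊤ : SimpleGraph (Fin (k - 1))).boxProd
      (SimpleGraph.cycleGraph 4)) v).filter fun u => f u.2 = Strategy.D).card = m := by
    convert hm'
  rw [hn2, hm2, if_pos]
  push_cast
  exact hw

theorem step_zero (k : ℕ) (hk : 3 < k) (w : ℝ) (hw1 : 1 / 2 ≤ w)
    (hw2 : w < ((k : ℝ) - 1) / ((k : ℝ) + 1)) :
    step ((⊤ : SimpleGraph (Fin (k - 1))).boxProd (SimpleGraph.cycleGraph 4)) w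
      (fun p => if p.2 = 0 then Strategy.C else Strategy.D) =
      fun p => if p.2 = 2 then Strategy.D else Strategy.C := by
  have hk' : (3 : ℝ) < k := by exact_mod_cast hk
  have hc : ((k - 1 : ℕ) : ℝ) = (k : ℝ) - 1 := by
    rw [Nat.cast_sub (by omega)]
    simp
  have a1 : 1 / (k : ℝ) < 1 / ((k : ℝ) - 1) :=
    one_div_lt_one_div_of_lt (by linarith) (by linarith)
  have a2 : 1 / ((k : ℝ) + 1) < 1 / (k : ℝ) :=
    one_div_lt_one_div_of_lt (by linarith) (by linarith)
  have e1 : (1 : ℝ) / ((k : ℝ) + 1) ≤ w := by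
    refine le_trans ?_ hw1
    rw [div_le_div_iff₀ (by linarith) (by norm_num)]
    linarith
  refine step_layer k w (fun i => if i = 0 then Strategy.C else Strategy.D)
    (fun i => if i = 2 then Strategy.D else Strategy.C)
    ![1 / ((k : ℝ) - 1), 1 / (k : ℝ), 1 / ((k : ℝ) + 1), 1 / (k : ℝ)] ?_ ?_
  · rintro ⟨a, i⟩
    fin_cases i
    · refine (power_C k hk w
        (fun i => if i = 0 then Strategy.C else Strategy.D) (a, 0) (k - 1) (by simp) (by simp)
        (by rw [hc]; exact hw2)).trans ?_
      simp [hc]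
    · refine (power_D k hk w
        (fun i => if i = 0 then Strategy.C else Strategy.D) (a, 1) 1 k (by simp) (by simp) (by simp; omega)
        (by simpa using e1)).trans ?_
      simp
    · refine (power_D k hk w
        (fun i => if i = 0 then Strategy.C else Strategy.D) (a, 2) 0 (k + 1) (by simp) (by simp) (by simp; omega)
        (by simp; linarith)).trans ?_
      simp
    · refine (power_D k hk w
        (fun i => if i = 0 then Strategy.C else Strategy.D) (a, 3) 1 k (by simp) (by simp) (by simp; omega)
        (by simpa using e1)).trans ?_
      simp
  · intro i
    fin_cases i
    · refine ⟨0, by decide, by decide, ?_⟩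
      intro l hl
      fin_cases l <;> simp [-one_div] at hl ⊢ <;>
        first | linarith | (constructor <;> first | linarith | (intro _; linarith))
    · refine ⟨0, by decide, by decide, ?_⟩
      intro l hl
      fin_cases l <;> simp [-one_div] at hl ⊢ <;>
        first | linarith | (constructor <;> first | linarith | (intro _; linarith))
    · refine ⟨1, by decide, by decide, ?_⟩
      intro l hl
      fin_cases l <;> simp [-one_div] at hl ⊢ <;>
        first | linarith | (constructor <;> first | linarith | (intro _; linarith))
    · refine ⟨0, by decide, by decide, ?_⟩
      intro l hl
      fin_cases l <;> simp [-one_div] at hl ⊢ <;>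
        first | linarith | (constructor <;> first | linarith | (intro _; linarith))

theorem step_one (k : ℕ) (hk : 3 < k) (w : ℝ) (hw1 : 1 / 2 ≤ w)
    (hw2 : w < ((k : ℝ) - 1) / ((k : ℝ) + 1)) :
    step ((⊤ : SimpleGraph (Fin (k - 1))).boxProd (SimpleGraph.cycleGraph 4)) w
      (fun p => if p.2 = 2 then Strategy.D else Strategy.C) =
      fun p => if p.2 = 0 then Strategy.C else Strategy.D := by
  have hk' : (3 : ℝ) < k := by exact_mod_cast hk
  have hc : ((k - 1 : ℕ) : ℝ) = (k : ℝ) - 1 := by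
    rw [Nat.cast_sub (by omega)]
    simp
  have a1 : 1 / (k : ℝ) < 1 / ((k : ℝ) - 1) :=
    one_div_lt_one_div_of_lt (by linarith) (by linarith)
  have a2 : 1 / ((k : ℝ) + 1) < 1 / (k : ℝ) :=
    one_div_lt_one_div_of_lt (by linarith) (by linarith)
  have e1 : (2 : ℝ) / ((k : ℝ) + 1) ≤ w := by
    refine le_trans ?_ hw1
    rw [div_le_div_iff₀ (by linarith) (by norm_num)]
    linarith
  have e2 : w < (k : ℝ) / ((k : ℝ) + 1) := by
    refine hw2.trans ?_
    gcongr
    linarith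
  have e3 : w < ((k + 1 : ℕ) : ℝ) / ((k : ℝ) + 1) := by
    refine hw2.trans ?_
    push_cast
    gcongr
    linarith
  refine step_layer k w (fun i => if i = 2 then Strategy.D else Strategy.C)
    (fun i => if i = 0 then Strategy.C else Strategy.D)
    ![1 / ((k : ℝ) + 1), 1 / (k : ℝ), 1 / ((k : ℝ) - 1), 1 / (k : ℝ)] ?_ ?_
  · rintro ⟨a, i⟩
    fin_cases i
    · refine (power_C k hk w
        (fun i => if i = 2 then Strategy.D else Strategy.C) (a, 0) (k + 1) (by simp) (by simp; omega) e3).trans ?_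
      simp
    · refine (power_C k hk w
        (fun i => if i = 2 then Strategy.D else Strategy.C) (a, 1) k (by simp) (by simp; omega) e2).trans ?_
      simp
    · refine (power_D k hk w
        (fun i => if i = 2 then Strategy.D else Strategy.C) (a, 2) 2 (k - 1) (by simp) (by simp) (by simp)
        (by simpa using e1)).trans ?_
      simp [hc]
    · refine (power_C k hk w
        (fun i => if i = 2 then Strategy.D else Strategy.C) (a, 3) k (by simp) (by simp; omega) e2).trans ?_
      simp
  · intro i
    fin_cases i
    · refine ⟨1, by decide, by decide, ?_⟩
      intro l hl
      fin_cases l <;> simp [-one_div] at hl ⊢ <;>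
        first | linarith | (constructor <;> first | linarith | (intro _; linarith))
    · refine ⟨2, by decide, by decide, ?_⟩
      intro l hl
      fin_cases l <;> simp [-one_div] at hl ⊢ <;>
        first | linarith | (constructor <;> first | linarith | (intro _; linarith))
    · refine ⟨2, by decide, by decide, ?_⟩
      intro l hl
      fin_cases l <;> simp [-one_div] at hl ⊢ <;>
        first | linarith | (constructor <;> first | linarith | (intro _; linarith))
    · refine ⟨2, by decide, by decide, ?_⟩
      intro l hl
      fin_cases l <;> simp [-one_div] at hl ⊢ <;>
        first | linarith | (constructor <;> first | linarith | (intro _; linarith))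

/-- Let `k > 3` and `G = K_{k-1} □ C_4` (which is `k`-regular), with
the four copies of `K_{k-1}` indexed by the second coordinate. Starting from the
configuration in which the copy with second coordinate `0` consists of collaborators
and all other vertices are defectors, for every win condition
`1/2 ≤ w < (k-1)/(k+1)` the `w`-power index process satisfies `C_2 = C_0` and
`C_1 ≠ C_0`; in particular it is periodic with period `2`. -/
theorem statement8 (k : ℕ) (hk : 3 < k) (w : ℝ) (hw1 : 1 / 2 ≤ w)
    (hw2 : w < ((k : ℝ) - 1) / ((k : ℝ) + 1)) :
    ∀ (G : SimpleGraph (Fin (k - 1) × Fin 4)) (c0 : Fin (k - 1) × Fin 4 → Strategy),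
      G = (⊤ : SimpleGraph (Fin (k - 1))).boxProd (SimpleGraph.cycleGraph 4) →
      c0 = (fun p => if p.2 = 0 then Strategy.C else Strategy.D) →
      configSeq G w c0 2 = c0 ∧ configSeq G w c0 1 ≠ c0 ∧
        EventuallyPeriodicWithPeriod G w c0 2 := by
  rintro G c0 rfl rfl
  have s0 := step_zero k hk w hw1 hw2
  have s1 := step_one k hk w hw1 hw2
  have h2 : configSeq ((⊤ : SimpleGraph (Fin (k - 1))).boxProd (SimpleGraph.cycleGraph 4)) w
      (fun p => if p.2 = 0 then Strategy.C else Strategy.D) 2 =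
      (fun p => if p.2 = 0 then Strategy.C else Strategy.D) := by
    simp only [configSeq]
    rw [s0, s1]
  refine ⟨h2, ?_, ⟨by norm_num, 0, h2⟩, fun m hm => hm.1⟩
  simp only [configSeq]
  rw [s0]
  intro h
  have := congrFun h (⟨0, by omega⟩, 1)
  simp at this
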